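/- arXiv:1507.01162 — 4 statements merged into one kernel-verified Lean document; each statement's English description precedes it below -/
import Mathlib

section
/- Let G be a finite group with prime factorization |G| = ∏_{j=1}^k p_j^{a_j}. Then for every logarithmic signature α = [A_1, ..., A_s] of G, the length satisfies ℓ(α) = Σ_{i=1}^s |A_i| ≥ Σ_{j=1}^k a_j · p_j. -/
/-- The product map of a sequence of blocks: `(a₁, …, aₛ) ↦ a₁ ⋯ aₛ`. -/
def lsProd {G : Type*} [Group G] {s : ℕ} (A : Fin s → Finset G)
    (a : ∀ i, (A i : Finset G)) : G :=
  (List.ofFn fun i => ((a i : G))).prod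

/-- The length of a sequence of blocks: the sum of their cardinalities. -/
def lsLength {G : Type*} [Group G] {s : ℕ} (A : Fin s → Finset G) : ℕ :=
  ∑ i, (A i).card

/-- The minimal possible length `Σ aⱼ pⱼ` for a set of size `n = ∏ pⱼ^{aⱼ}`. -/
def lsTarget (n : ℕ) : ℕ :=
  n.factorization.sum fun p a => a * p

/-- `A` is a logarithmic signature for the group `G`: the product map is a bijection. -/
def IsLS {G : Type*} [Group G] {s : ℕ} (A : Fin s → Finset G) : Prop :=
  Function.Bijective (lsProd A)

/-- `B` is a logarithmic signature for the finite subset `S` of `G`: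
the product map is injective with image exactly `S`. -/
def IsLSFor {G : Type*} [Group G] (S : Finset G) {t : ℕ} (B : Fin t → Finset G) : Prop :=
  Function.Injective (lsProd B) ∧ ∀ g : G, g ∈ S ↔ ∃ b, lsProd B b = g

/-- The group `G` admits a minimal logarithmic signature. -/
def HasMLS (G : Type*) [Group G] : Prop :=
  ∃ (s : ℕ) (A : Fin s → Finset G), IsLS A ∧ lsLength A = lsTarget (Nat.card G)

/-- The finite subset `S` of `G` admits a minimal logarithmic signature. -/
def HasMLSFor {G : Type*} [Group G] (S : Finset G) : Prop :=
  ∃ (t : ℕ) (B : Fin t → Finset G), IsLSFor S B ∧ lsLength B = lsTarget S.card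

theorem lsTarget_mul {m n : ℕ} (hm : m ≠ 0) (hn : n ≠ 0) :
    lsTarget (m * n) = lsTarget m + lsTarget n := by
  unfold lsTarget
  rw [Nat.factorization_mul hm hn]
  exact Finsupp.sum_add_index' (fun p => zero_mul p) fun p a b => add_mul a b p

theorem lsTarget_one : lsTarget 1 = 0 := by simp [lsTarget]

theorem lsTarget_prime {p : ℕ} (hp : p.Prime) : lsTarget p = p := by
  simp [lsTarget, hp.factorization]

theorem lsTarget_le_self (n : ℕ) : lsTarget n ≤ n := by
  induction n using induction_on_primes with
  | zero => simp [lsTarget]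
  | one => simp [lsTarget]
  | prime_mul p a hp ih =>
    rcases a with _ | _ | a
    · simp [lsTarget]
    · simp [lsTarget_prime hp]
    · rw [lsTarget_mul hp.ne_zero (by omega), lsTarget_prime hp]
      have := hp.two_le
      nlinarith

theorem lsTarget_prod {ι : Type*} (t : Finset ι) (f : ι → ℕ) (hf : ∀ i ∈ t, f i ≠ 0) :
    lsTarget (∏ i ∈ t, f i) = ∑ i ∈ t, lsTarget (f i) := by
  classical
  induction t using Finset.induction_on with
  | empty => simp [lsTarget_one]
  | insert i t hi ih =>
    have hft : ∀ j ∈ t, f j ≠ 0 := fun j hj => hf j (Finset.mem_insert_of_mem hj)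
    rw [Finset.prod_insert hi, Finset.sum_insert hi,
      lsTarget_mul (hf i (Finset.mem_insert_self i t)) (Finset.prod_ne_zero_iff.2 hft), ih hft]

theorem IsLS.card_eq_prod {G : Type*} [Group G] {s : ℕ} {A : Fin s → Finset G} (hA : IsLS A) :
    Nat.card G = ∏ i, (A i).card := by
  rw [← Nat.card_eq_of_bijective _ hA, Nat.card_pi]
  simp

/-- every logarithmic signature of a finite group `G` has length at least
`Σⱼ aⱼ pⱼ`, where `|G| = ∏ⱼ pⱼ^{aⱼ}` is the prime factorization of `|G|`. -/
theorem ls_length_lower_bound {G : Type*} [Group G] [Finite G] {s : ℕ}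
    (A : Fin s → Finset G) (hA : IsLS A) :
    lsTarget (Nat.card G) ≤ lsLength A := by
  have hcard : ∏ i, (A i).card ≠ 0 := hA.card_eq_prod ▸ Nat.card_pos.ne'
  rw [hA.card_eq_prod, lsTarget_prod _ _ (Finset.prod_ne_zero_iff.1 hcard)]
  exact Finset.sum_le_sum fun i _ => lsTarget_le_self _
end

section
/- Let G be a finite group and x ∈ G an element of order t. For any natural number s with 1 ≤ s ≤ t, the cyclic set S = {x^i : 0 ≤ i < s} admits a minimal logarithmic signature α = [A_1, ..., A_k] with the additional property that there exists a list of exponents [j_1, ..., j_k] such that x^{j_i} ∈ A_i for each 1 ≤ i ≤ k and Σ_{i=1}^k j_i < s. -/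
theorem lsProd_succ {G : Type*} [Group G] {k : ℕ} (A : Fin (k + 1) → Finset G)
    (a : ∀ i, (A i : Finset G)) :
    lsProd A a = (a 0 : G) * lsProd (fun i => A i.succ) (fun i => a i.succ) := by
  simp [lsProd, List.ofFn_succ]

theorem lsTarget_prime_mul {p n : ℕ} (hp : p.Prime) (hn : n ≠ 0) :
    lsTarget (p * n) = p + lsTarget n := by
  unfold lsTarget
  rw [Nat.factorization_mul hp.ne_zero hn, Finsupp.sum_add_index' (by simp)
    (fun _ _ _ => add_mul _ _ _), hp.factorization, Finsupp.sum_single_index (by simp), one_mul]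

/-- Prepending a block `B` to a logarithmic signature for `S` gives one for `T`, provided that
multiplication is a bijection from `B × S` onto `T`. -/
theorem IsLSFor.cons {G : Type*} [Group G] {S T B : Finset G} {k : ℕ} {A : Fin k → Finset G}
    (hA : IsLSFor S A)
    (hinj : ∀ b ∈ B, ∀ b' ∈ B, ∀ y ∈ S, ∀ y' ∈ S, b * y = b' * y' → b = b' ∧ y = y')
    (hT : ∀ g, g ∈ T ↔ ∃ b ∈ B, ∃ y ∈ S, b * y = g) :
    IsLSFor T (Fin.cons B A : Fin (k + 1) → Finset G) := by
  refine ⟨fun a a' h => ?_, fun g => ?_⟩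
  · rw [lsProd_succ, lsProd_succ] at h
    obtain ⟨h0, h1⟩ := hinj _ (a 0).2 _ (a' 0).2 _ ((hA.2 _).2 ⟨fun i => a i.succ, rfl⟩) _
      ((hA.2 _).2 ⟨fun i => a' i.succ, rfl⟩) h
    have htail := hA.1 h1
    funext i
    refine Fin.cases (Subtype.ext h0) (fun i => ?_) i
    exact congrFun htail i
  · rw [hT]
    constructor
    · rintro ⟨b, hb, y, hy, rfl⟩
      obtain ⟨c, rfl⟩ := (hA.2 y).1 hy
      let a : ∀ i, ((Fin.cons B A : Fin (k + 1) → Finset G) i : Finset G) :=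
        Fin.cases ⟨b, hb⟩ c
      exact ⟨a, lsProd_succ _ a⟩
    · rintro ⟨a, rfl⟩
      exact ⟨_, (a 0).2, _, (hA.2 _).2 ⟨fun i => a i.succ, rfl⟩, (lsProd_succ _ a).symm⟩

theorem card_image_range_pow {G : Type*} [Group G] [DecidableEq G] {x : G} {s : ℕ}
    (hs : s ≤ orderOf x) : ((Finset.range s).image fun i => x ^ i).card = s := by
  rw [Finset.card_image_of_injOn, Finset.card_range]
  intro i hi j hj h
  rw [Finset.mem_coe, Finset.mem_range] at hi hj
  exact pow_injOn_Iio_orderOf (hi.trans_le hs) (hj.trans_le hs) h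

/-- The mixed radix expansion: prepending `{x ^ (n * c) : c < p}` to a logarithmic signature for
`{x ^ i : i < n}` gives one for `{x ^ i : i < p * n}`. -/
theorem IsLSFor.cons_pow {G : Type*} [Group G] [DecidableEq G] {x : G} {p n k : ℕ}
    (hpn : p * n ≤ orderOf x) {A : Fin k → Finset G}
    (hA : IsLSFor ((Finset.range n).image fun i => x ^ i) A) :
    IsLSFor ((Finset.range (p * n)).image fun i => x ^ i)
      (Fin.cons ((Finset.range p).image fun c => x ^ (n * c)) A : Fin (k + 1) → Finset G) := by
  have hlt : ∀ c < p, ∀ r < n, n * c + r < p * n := fun c hc r hr => by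
    nlinarith
  refine hA.cons ?_ fun g => ?_
  · simp only [Finset.mem_image, Finset.mem_range]
    rintro _ ⟨c, hc, rfl⟩ _ ⟨c', hc', rfl⟩ _ ⟨r, hr, rfl⟩ _ ⟨r', hr', rfl⟩ h
    rw [← pow_add, ← pow_add] at h
    have he : n * c + r = n * c' + r' := pow_injOn_Iio_orderOf
      ((hlt c hc r hr).trans_le hpn) ((hlt c' hc' r' hr').trans_le hpn) h
    have hr_eq : r = r' := by
      simpa [Nat.mul_add_mod, Nat.mod_eq_of_lt hr, Nat.mod_eq_of_lt hr'] using
        congrArg (· % n) he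
    subst hr_eq
    exact ⟨by rw [Nat.add_right_cancel he], rfl⟩
  · simp only [Finset.mem_image, Finset.mem_range]
    constructor
    · rintro ⟨i, hi, rfl⟩
      have hn : 0 < n := Nat.pos_of_ne_zero fun h => by simp [h] at hi
      exact ⟨_, ⟨i / n, (Nat.div_lt_iff_lt_mul hn).2 hi, rfl⟩, _, ⟨i % n, Nat.mod_lt _ hn, rfl⟩,
        by rw [← pow_add, Nat.div_add_mod]⟩
    · rintro ⟨_, ⟨c, hc, rfl⟩, _, ⟨r, hr, rfl⟩, rfl⟩
      exact ⟨n * c + r, hlt c hc r hr, pow_add _ _ _⟩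

theorem exists_isLSFor_image_range_pow {G : Type*} [Group G] [DecidableEq G] (x : G) (s : ℕ)
    (hs1 : 1 ≤ s) (hs : s ≤ orderOf x) :
    ∃ (k : ℕ) (A : Fin k → Finset G),
      IsLSFor ((Finset.range s).image fun i => x ^ i) A ∧ lsLength A = lsTarget s ∧
      ∀ i, 1 ∈ A i := by
  induction s using induction_on_primes with
  | zero => omega
  | one =>
    refine ⟨0, Fin.elim0, ⟨Function.injective_of_subsingleton _, fun g => ?_⟩, ?_, fun i => i.elim0⟩
    · simp [lsProd, eq_comm]
    · simp [lsLength, lsTarget_one]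
  | prime_mul p n hp ih =>
    have hn : n ≠ 0 := by rintro rfl; simp at hs1
    have hpow : ((Finset.range p).image fun c => x ^ (n * c)).card = p := by
      rw [Finset.card_image_of_injOn, Finset.card_range]
      intro c hc d hd h
      rw [Finset.mem_coe, Finset.mem_range] at hc hd
      have hlt : ∀ e < p, n * e < orderOf x := fun e he =>
        (Nat.mul_lt_mul_of_pos_left he (Nat.pos_of_ne_zero hn)).trans_le (mul_comm n p ▸ hs)
      exact Nat.eq_of_mul_eq_mul_left (Nat.pos_of_ne_zero hn)
        (pow_injOn_Iio_orderOf (hlt c hc) (hlt d hd) h)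
    obtain ⟨k, A, hA, hlen, hone⟩ := ih (Nat.one_le_iff_ne_zero.2 hn)
      ((Nat.le_mul_of_pos_left n hp.pos).trans hs)
    refine ⟨k + 1, _, hA.cons_pow hs, ?_, fun i => ?_⟩
    · rw [lsTarget_prime_mul hp hn, ← hlen, lsLength, Fin.sum_univ_succ]
      simp [hpow, lsLength]
    · refine Fin.cases ?_ (fun i => ?_) i
      · exact Finset.mem_image.2 ⟨0, Finset.mem_range.2 hp.pos, by simp⟩
      · exact hone i

/-- for `x ∈ G` of order `t` and `1 ≤ s ≤ t`, the cyclic set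
`S = {xⁱ : 0 ≤ i < s}` admits an MLS `[A₁, …, A_k]` together with exponents
`[j₁, …, j_k]` such that `x^{jᵢ} ∈ Aᵢ` for each `i` and `Σᵢ jᵢ < s`. -/
theorem hasMLS_cyclic_set {G : Type*} [Group G] [Finite G] [DecidableEq G]
    (x : G) (t s : ℕ) (ht : orderOf x = t) (hs1 : 1 ≤ s) (hst : s ≤ t) :
    ∃ (k : ℕ) (A : Fin k → Finset G),
      IsLSFor ((Finset.range s).image fun i => x ^ i) A ∧
      lsLength A = lsTarget ((Finset.range s).image fun i => x ^ i).card ∧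
      ∃ j : Fin k → ℕ, (∀ i, x ^ (j i) ∈ A i) ∧ ∑ i, j i < s := by
  subst ht
  obtain ⟨k, A, hA, hlen, hone⟩ := exists_isLSFor_image_range_pow x s hs1 hst
  refine ⟨k, A, hA, ?_, fun _ => 0, fun i => ?_, ?_⟩
  · rw [card_image_range_pow hst, hlen]
  · simpa using hone i
  · simpa using Nat.lt_of_lt_of_le Nat.zero_lt_one hs1
end

section
/- Let G be a finite group and let H, K be subgroups of G with H ∩ K = {1} and |G| = |H|·|K|. If both H and K admit minimal logarithmic signatures, then G admits a minimal logarithmic signature. -/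
theorem isLS_iff_existsUnique {G : Type*} [Group G] {s : ℕ} (A : Fin s → Finset G) :
    IsLS A ↔ ∀ g : G, ∃! f : Fin s → G, (∀ i, f i ∈ A i) ∧ (List.ofFn f).prod = g := by
  unfold IsLS
  rw [Function.bijective_iff_existsUnique]
  refine forall_congr' fun g => ⟨?_, ?_⟩
  · rintro ⟨a, ha, hu⟩
    refine ⟨fun i => a i, ⟨fun i => (a i).2, ha⟩, ?_⟩
    rintro f ⟨hf, hfg⟩
    rw [← hu (fun i => ⟨f i, hf i⟩) hfg]
  · rintro ⟨f, ⟨hf, hfg⟩, hu⟩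
    refine ⟨fun i => ⟨f i, hf i⟩, hfg, fun b hb => ?_⟩
    funext i
    exact Subtype.ext (congrFun (hu (fun i => b i) ⟨fun i => (b i).2, hb⟩) i)

/-- The concatenation, in `G`, of sequences of blocks of two subgroups. -/
def lsAppend {G : Type*} [Group G] {H K : Subgroup G} {s t : ℕ}
    (A : Fin s → Finset H) (B : Fin t → Finset K) : Fin (s + t) → Finset G :=
  Fin.append (fun i => (A i).map (Function.Embedding.subtype _))
    (fun j => (B j).map (Function.Embedding.subtype _))

theorem lsLength_lsAppend {G : Type*} [Group G] {H K : Subgroup G} {s t : ℕ}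
    (A : Fin s → Finset H) (B : Fin t → Finset K) :
    lsLength (lsAppend A B) = lsLength A + lsLength B := by
  simp [lsLength, lsAppend, Fin.sum_univ_add]

theorem prod_ofFn_append {G : Type*} [Group G] {H K : Subgroup G} {s t : ℕ}
    (f : Fin s → H) (k : Fin t → K) :
    (List.ofFn (Fin.append (fun i => (f i : G)) fun j => (k j : G))).prod =
      (List.ofFn f).prod * (List.ofFn k).prod := by
  rw [List.ofFn_fin_append, List.prod_append, Subgroup.val_list_prod, Subgroup.val_list_prod,
    List.map_ofFn, List.map_ofFn]
  rfl

theorem forall_mem_lsAppend_iff {G : Type*} [Group G] {H K : Subgroup G} {s t : ℕ}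
    (A : Fin s → Finset H) (B : Fin t → Finset K) (c : Fin (s + t) → G) :
    (∀ i, c i ∈ lsAppend A B i) ↔ ∃ (f : Fin s → H) (k : Fin t → K),
      (∀ i, f i ∈ A i) ∧ (∀ j, k j ∈ B j) ∧
        c = Fin.append (fun i => (f i : G)) fun j => (k j : G) := by
  constructor
  · intro hc
    have hA : ∀ i, ∃ h ∈ A i, (h : G) = c (Fin.castAdd t i) := fun i => by
      simpa [lsAppend] using hc (Fin.castAdd t i)
    have hB : ∀ j, ∃ k ∈ B j, (k : G) = c (Fin.natAdd s j) := fun j => by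
      simpa [lsAppend] using hc (Fin.natAdd s j)
    choose f hf hfc using hA
    choose k hk hkc using hB
    refine ⟨f, k, hf, hk, ?_⟩
    funext i
    refine Fin.addCases (fun i => ?_) (fun j => ?_) i
    · simp [hfc]
    · simp [hkc]
  · rintro ⟨f, k, hf, hk, rfl⟩ i
    refine Fin.addCases (fun i => ?_) (fun j => ?_) i
    · simpa [lsAppend] using hf i
    · simpa [lsAppend] using hk j

theorem IsLS.lsAppend {G : Type*} [Group G] {H K : Subgroup G} (hHK : H.IsComplement' K)
    {s t : ℕ} {A : Fin s → Finset H} {B : Fin t → Finset K} (hA : IsLS A) (hB : IsLS B) :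
    IsLS (lsAppend A B) := by
  rw [isLS_iff_existsUnique] at hA hB ⊢
  intro g
  obtain ⟨⟨x, y⟩, rfl⟩ := hHK.2 g
  obtain ⟨f, ⟨hf, rfl⟩, hfu⟩ := hA x
  obtain ⟨k, ⟨hk, rfl⟩, hku⟩ := hB y
  refine ⟨Fin.append (fun i => (f i : G)) fun j => (k j : G),
    ⟨(forall_mem_lsAppend_iff A B _).2 ⟨f, k, hf, hk, rfl⟩, prod_ofFn_append f k⟩, ?_⟩
  rintro c ⟨hc, hcg⟩
  obtain ⟨f', k', hf', hk', rfl⟩ := (forall_mem_lsAppend_iff A B c).1 hc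
  rw [prod_ofFn_append] at hcg
  have h := hHK.1 (a₁ := ((List.ofFn f').prod, (List.ofFn k').prod)) hcg
  rw [Prod.mk.injEq] at h
  rw [hfu f' ⟨hf', h.1⟩, hku k' ⟨hk', h.2⟩]

/-- if `H, K ≤ G` with `H ∩ K = {1}` and `|G| = |H|·|K|`, and both `H`
and `K` admit minimal logarithmic signatures, then `G` admits one. -/
theorem hasMLS_of_trivial_inter {G : Type*} [Group G] [Finite G]
    (H K : Subgroup G) (hinter : H ⊓ K = ⊥)
    (hcard : Nat.card G = Nat.card H * Nat.card K)
    (hH : HasMLS H) (hK : HasMLS K) :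
    HasMLS G := by
  obtain ⟨s, A, hA, hAl⟩ := hH
  obtain ⟨t, B, hB, hBl⟩ := hK
  have hHK : H.IsComplement' K :=
    Subgroup.isComplement'_of_card_mul_and_disjoint hcard.symm (disjoint_iff.2 hinter)
  refine ⟨s + t, lsAppend A B, hA.lsAppend hHK hB, ?_⟩
  rw [lsLength_lsAppend, hAl, hBl, hcard, lsTarget_mul Nat.card_pos.ne' Nat.card_pos.ne']
end

section
/- Let G be a finite group and H a subgroup of G whose index [G : H] is a prime number p. If H admits a minimal logarithmic signature, then G admits a minimal logarithmic signature (obtained by prepending a left transversal of H in G, which is a block of size p, to an MLS of H). -/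
/-- Prepending a block multiplies the product on the left. -/
theorem lsProd_cons {G : Type*} [Group G] {s : ℕ} (T : Finset G) (B : Fin s → Finset G)
    (a : ∀ i, (Fin.cons T B : Fin (s + 1) → Finset G) i) :
    lsProd (Fin.cons T B) a = (a 0 : G) * lsProd B fun i => a i.succ := by
  simp only [lsProd, List.ofFn_succ, List.prod_cons]

theorem lsLength_cons {G : Type*} [Group G] {s : ℕ} (T : Finset G) (B : Fin s → Finset G) :
    lsLength (Fin.cons T B : Fin (s + 1) → Finset G) = T.card + lsLength B := by
  simp [lsLength, Fin.sum_univ_succ]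

/-- An injective homomorphism carries the product map to that of the image blocks. -/
theorem lsProd_map {G K : Type*} [Group G] [Group K] (f : K →* G)
    (hf : Function.Injective f) {s : ℕ} (A : Fin s → Finset K) (b : ∀ i, A i) :
    lsProd (fun i => (A i).map ⟨f, hf⟩)
      (fun i => ⟨f (b i), Finset.mem_map_of_mem ⟨f, hf⟩ (b i).2⟩) = f (lsProd A b) := by
  simp only [lsProd, map_list_prod, List.map_ofFn]
  rfl

theorem exists_eq_map {G K : Type*} [Group G] [Group K] (f : K →* G)
    (hf : Function.Injective f) {s : ℕ} (A : Fin s → Finset K)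
    (c : ∀ i, (A i).map ⟨f, hf⟩) :
    ∃ b : ∀ i, A i, c = fun i => ⟨f (b i), Finset.mem_map_of_mem ⟨f, hf⟩ (b i).2⟩ := by
  choose b hb hbc using fun i => Finset.mem_map.1 (c i).2
  exact ⟨fun i => ⟨b i, hb i⟩, funext fun i => Subtype.ext (hbc i).symm⟩

/-- A left transversal of `H` followed by a logarithmic signature for `H` is a logarithmic
signature for `G`. -/
theorem IsLS.cons_transversal {G : Type*} [Group G] {H : Subgroup G} {T : Finset G}
    (hT : Subgroup.IsComplement (T : Set G) H) {s : ℕ} {A : Fin s → Finset H} (hA : IsLS A) :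
    IsLS (Fin.cons T fun i => (A i).map ⟨H.subtype, H.subtype_injective⟩ :
      Fin (s + 1) → Finset G) := by
  constructor
  · intro a a' h
    rw [lsProd_cons, lsProd_cons] at h
    obtain ⟨b, hb⟩ := exists_eq_map H.subtype H.subtype_injective A fun i => a i.succ
    obtain ⟨b', hb'⟩ := exists_eq_map H.subtype H.subtype_injective A fun i => a' i.succ
    rw [hb, hb', lsProd_map, lsProd_map] at h
    have key := @hT.1 (⟨a 0, (a 0).2⟩, lsProd A b) (⟨a' 0, (a' 0).2⟩, lsProd A b') h
    obtain ⟨h0, h1⟩ := Prod.ext_iff.1 key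
    have hbb : b = b' := hA.1 h1
    subst hbb
    funext i
    refine Fin.cases ?_ (fun j => ?_) i
    · exact Subtype.ext (congrArg Subtype.val h0)
    · exact congrFun (hb.trans hb'.symm) j
  · intro g
    obtain ⟨⟨t, h⟩, rfl⟩ := hT.2 g
    obtain ⟨b, rfl⟩ := hA.2 h
    refine ⟨Fin.cons (α := fun i => (Fin.cons T (fun i => (A i).map
      ⟨H.subtype, H.subtype_injective⟩) : Fin (s + 1) → Finset G) i) ⟨t, t.2⟩
      (fun i => ⟨H.subtype (b i), Finset.mem_map_of_mem _ (b i).2⟩), ?_⟩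
    rw [lsProd_cons]
    exact congrArg ((t : G) * ·) (lsProd_map H.subtype H.subtype_injective A b)

/-- if `H ≤ G` has prime index `p` and `H` admits a minimal logarithmic
signature, then `G` admits a minimal logarithmic signature. -/
theorem hasMLS_of_prime_index {G : Type*} [Group G] [Finite G]
    (H : Subgroup G) (p : ℕ) (hp : p.Prime) (hidx : H.index = p)
    (hH : HasMLS H) : HasMLS G := by
  obtain ⟨s, A, hA, hlen⟩ := hH
  obtain ⟨T, hT, -⟩ := H.exists_isComplement_left 1
  lift T to Finset G using T.toFinite
  refine ⟨s + 1, _, hA.cons_transversal hT, ?_⟩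
  have hcard : T.card = p := by
    simpa [hidx] using hT.card_left
  have hmap : lsLength (fun i => (A i).map ⟨H.subtype, H.subtype_injective⟩) = lsLength A := by
    simp [lsLength]
  rw [lsLength_cons, hmap, hcard, hlen, ← H.index_mul_card, hidx,
    lsTarget_mul hp.ne_zero Nat.card_pos.ne', lsTarget_prime hp]
end
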